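/- Every optimal set of three-means for the condensation measure P equals {19/195, 7/15, 35/39} (that is, {S₁(19/39), E(ν), S₂(19/39)}), and the third quantization error of P is V_3(P) = 30232/6476925. -/

import Mathlib

open MeasureTheory Metric Set Filter

/-- The distortion error of a set `α` of quantizer points for `μ`, of order 2:
`∫ min_{a ∈ α} (x - a)^2 dμ(x)`. -/
noncomputable def distortion (μ : MeasureTheory.Measure ℝ) (α : Set ℝ) : ℝ :=
  ∫ x, (Metric.infDist x α) ^ 2 ∂μ

/-- The `n`th quantization error of order 2 for `μ`. -/
noncomputable def quantErr (μ : MeasureTheory.Measure ℝ) (n : ℕ) : ℝ :=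
  sInf {e : ℝ | ∃ α : Set ℝ, α.Finite ∧ α.Nonempty ∧ α.ncard ≤ n ∧ e = distortion μ α}

/-- `α` is an optimal set of `n`-means for `μ`. -/
def IsOptimalSet (μ : MeasureTheory.Measure ℝ) (n : ℕ) (α : Set ℝ) : Prop :=
  α.Finite ∧ α.Nonempty ∧ α.ncard ≤ n ∧ distortion μ α = quantErr μ n

/-- The similarity `S₁(x) = x/5`. -/
noncomputable def S1 : ℝ → ℝ := fun x => x / 5

/-- The similarity `S₂(x) = x/5 + 4/5`. -/
noncomputable def S2 : ℝ → ℝ := fun x => x / 5 + 4 / 5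

/-- `P` is the condensation measure associated with `(S₁, S₂; 1/3, 1/3, 1/3; ν)`:
`P = (1/3) P∘S₁⁻¹ + (1/3) P∘S₂⁻¹ + (1/3) ν`. -/
def IsCondensation (P ν : MeasureTheory.Measure ℝ) : Prop :=
  MeasureTheory.IsProbabilityMeasure P ∧
    P = (1 / 3 : ENNReal) • P.map S1 + (1 / 3 : ENNReal) • P.map S2 + (1 / 3 : ENNReal) • ν

/-- The point `a_{j+1} = 3/5 - 1/(5 · 2^j)` (so `aseq 0 = a₁ = 2/5`). -/
noncomputable def aseq (j : ℕ) : ℝ := 3 / 5 - 1 / (5 * 2 ^ j)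

/-- The infinite discrete distribution `ν = ∑_{j ≥ 1} 2^{-j} δ_{a_j}`. -/
noncomputable def nuDisc : MeasureTheory.Measure ℝ :=
  MeasureTheory.Measure.sum
    (fun j : ℕ => ((1 / 2 : ENNReal) ^ (j + 1)) • MeasureTheory.Measure.dirac (aseq j))

lemma continuous_S1 : Continuous S1 := by unfold S1; fun_prop

lemma continuous_S2 : Continuous S2 := by unfold S2; fun_prop

lemma aseq_mem (j : ℕ) : aseq j ∈ Icc (2 / 5 : ℝ) (3 / 5) := by
  have h : (1 : ℝ) ≤ 2 ^ j := one_le_pow₀ (by norm_num)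
  have h0 : (0 : ℝ) < 5 * 2 ^ j := by positivity
  have h1 : (1 : ℝ) / (5 * 2 ^ j) ≤ 1 / 5 := by
    rw [div_le_div_iff₀ h0 (by norm_num)]; linarith
  have h2 : (0 : ℝ) ≤ 1 / (5 * 2 ^ j) := by positivity
  unfold aseq
  constructor <;> linarith

lemma nuDisc_compl_Icc : nuDisc (Icc (0 : ℝ) 1)ᶜ = 0 := by
  rw [nuDisc, Measure.sum_apply _ measurableSet_Icc.compl]
  refine ENNReal.tsum_eq_zero.2 fun j => ?_
  have h := aseq_mem j
  have h' : aseq j ∈ Icc (0 : ℝ) 1 := ⟨by linarith [h.1], by linarith [h.2]⟩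
  simp [h'.1, h'.2]

lemma isFiniteMeasure_nuDisc : IsFiniteMeasure nuDisc := by
  constructor
  rw [nuDisc, Measure.sum_apply _ MeasurableSet.univ]
  simp only [Measure.smul_apply, measure_univ, smul_eq_mul, mul_one]
  simp only [pow_succ, ENNReal.tsum_mul_right, ENNReal.tsum_geometric]
  norm_num
  exact ENNReal.mul_lt_top (by simp) (by simp)

lemma integrable_of_compl_Icc {μ : Measure ℝ} [IsFiniteMeasure μ] (h : μ (Icc (0 : ℝ) 1)ᶜ = 0)
    {f : ℝ → ℝ} (hf : Continuous f) : Integrable f μ := by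
  have h1 : μ.restrict (Icc 0 1) = μ := Measure.restrict_eq_self_of_ae_mem (by
    rw [ae_iff]; exact h)
  rw [← h1]
  exact hf.continuousOn.integrableOn_compact isCompact_Icc

lemma integrable_nuDisc {f : ℝ → ℝ} (hf : Continuous f) : Integrable f nuDisc :=
  have := isFiniteMeasure_nuDisc
  integrable_of_compl_Icc nuDisc_compl_Icc hf

lemma hasSum_integral_nuDisc {f : ℝ → ℝ} (hf : Continuous f) :
    HasSum (fun j : ℕ => (1 / 2 : ℝ) ^ (j + 1) * f (aseq j)) (∫ x, f x ∂nuDisc) := by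
  have h := hasSum_integral_measure (integrable_nuDisc hf)
  have e : (fun j : ℕ => (1 / 2 : ℝ) ^ (j + 1) * f (aseq j)) =
      fun j => ∫ x, f x ∂((1 / 2 : ENNReal) ^ (j + 1) • Measure.dirac (aseq j)) := by
    funext j
    rw [integral_smul_measure, integral_dirac]
    simp
  rw [e]
  exact h

lemma integral_sq_sub_nuDisc (t : ℝ) :
    ∫ x, (x - t) ^ 2 ∂nuDisc = 8 / 1575 + (7 / 15 - t) ^ 2 := by
  refine (hasSum_integral_nuDisc (f := fun x => (x - t) ^ 2) (by fun_prop)).unique ?_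
  have g1 := (hasSum_geometric_of_lt_one (r := (1 / 2 : ℝ)) (by norm_num) (by norm_num)).mul_left
    ((3 / 5 - t) ^ 2 / 2)
  have g2 := (hasSum_geometric_of_lt_one (r := (1 / 4 : ℝ)) (by norm_num) (by norm_num)).mul_left
    (-(3 / 5 - t) / 5)
  have g3 := (hasSum_geometric_of_lt_one (r := (1 / 8 : ℝ)) (by norm_num) (by norm_num)).mul_left
    (1 / 50 : ℝ)
  have hsum : 8 / 1575 + (7 / 15 - t) ^ 2 = (3 / 5 - t) ^ 2 / 2 * (1 - 1 / 2)⁻¹ +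
      -(3 / 5 - t) / 5 * (1 - 1 / 4)⁻¹ + 1 / 50 * (1 - 1 / 8)⁻¹ := by
    norm_num
    ring
  have hterm : (fun j : ℕ => (1 / 2 : ℝ) ^ (j + 1) * (aseq j - t) ^ 2) =
      fun j => (3 / 5 - t) ^ 2 / 2 * (1 / 2) ^ j + -(3 / 5 - t) / 5 * (1 / 4) ^ j +
        1 / 50 * (1 / 8) ^ j := by
    funext j
    have e2 : (1 / 4 : ℝ) ^ j = ((1 / 2) ^ j) ^ 2 := by rw [← pow_mul, mul_comm, pow_mul]; norm_num
    have e3 : (1 / 8 : ℝ) ^ j = ((1 / 2) ^ j) ^ 3 := by rw [← pow_mul, mul_comm, pow_mul]; norm_num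
    have e : aseq j = 3 / 5 - (1 / 2) ^ j / 5 := by
      rw [aseq, one_div_pow]; field_simp
    rw [e, e2, e3, pow_succ]
    ring
  rw [hterm, hsum]
  exact (g1.add g2).add g3

lemma integral_nuDisc_mono {f g : ℝ → ℝ} (hf : Continuous f) (hg : Continuous g)
    (h : ∀ x ∈ Icc (2 / 5 : ℝ) (3 / 5), f x ≤ g x) : ∫ x, f x ∂nuDisc ≤ ∫ x, g x ∂nuDisc :=
  hasSum_le (fun j => mul_le_mul_of_nonneg_left (h _ (aseq_mem j)) (by positivity))
    (hasSum_integral_nuDisc hf) (hasSum_integral_nuDisc hg)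

lemma two_atoms_le_integral_nuDisc {f : ℝ → ℝ} (hf : Continuous f) (h0 : ∀ x, 0 ≤ f x) :
    f (2 / 5) / 2 + f (1 / 2) / 4 ≤ ∫ x, f x ∂nuDisc := by
  have h := sum_le_hasSum (Finset.range 2)
    (fun j _ => mul_nonneg (by positivity) (h0 (aseq j))) (hasSum_integral_nuDisc hf)
  have e0 : aseq 0 = 2 / 5 := by norm_num [aseq]
  have e1 : aseq 1 = 1 / 2 := by norm_num [aseq]
  rw [Finset.sum_range_succ, Finset.sum_range_one, e0, e1] at h
  linarith

namespace IsCondensation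

variable {P : Measure ℝ}

lemma compl_Icc (hP : IsCondensation P nuDisc) : P (Icc (0 : ℝ) 1)ᶜ = 0 := by
  have := hP.1
  have hm : MeasurableSet (Icc (0 : ℝ) 1)ᶜ := measurableSet_Icc.compl
  have h1 : P (S1 ⁻¹' (Icc (0 : ℝ) 1)ᶜ) ≤ P (Icc (0 : ℝ) 1)ᶜ := measure_mono fun x hx hx' =>
    hx ⟨by simp only [S1]; linarith [hx'.1], by simp only [S1]; linarith [hx'.2]⟩
  have h2 : P (S2 ⁻¹' (Icc (0 : ℝ) 1)ᶜ) ≤ P (Icc (0 : ℝ) 1)ᶜ := measure_mono fun x hx hx' =>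
    hx ⟨by simp only [S2]; linarith [hx'.1], by simp only [S2]; linarith [hx'.2]⟩
  have h : P (Icc (0 : ℝ) 1)ᶜ = (1 / 3 : ENNReal) * P (S1 ⁻¹' (Icc (0 : ℝ) 1)ᶜ)
      + (1 / 3 : ENNReal) * P (S2 ⁻¹' (Icc (0 : ℝ) 1)ᶜ) := by
    conv_lhs => rw [hP.2]
    simp only [Measure.add_apply, Measure.smul_apply, smul_eq_mul, nuDisc_compl_Icc,
      Measure.map_apply continuous_S1.measurable hm, Measure.map_apply continuous_S2.measurable hm,
      mul_zero, add_zero]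
  have hr := congrArg ENNReal.toReal h
  rw [ENNReal.toReal_add (ENNReal.mul_ne_top (by simp) (measure_ne_top _ _))
    (ENNReal.mul_ne_top (by simp) (measure_ne_top _ _)), ENNReal.toReal_mul,
    ENNReal.toReal_mul] at hr
  have h1r := ENNReal.toReal_mono (measure_ne_top _ _) h1
  have h2r := ENNReal.toReal_mono (measure_ne_top _ _) h2
  have e : (1 / 3 : ENNReal).toReal = 1 / 3 := by simp
  rw [e] at hr
  have h0 : (P (Icc (0 : ℝ) 1)ᶜ).toReal = 0 :=
    le_antisymm (by linarith) ENNReal.toReal_nonneg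
  exact ((ENNReal.toReal_eq_zero_iff _).1 h0).resolve_right (measure_ne_top _ _)

lemma integrable (hP : IsCondensation P nuDisc) {f : ℝ → ℝ} (hf : Continuous f) :
    Integrable f P :=
  have := hP.1
  integrable_of_compl_Icc hP.compl_Icc hf

lemma integral_mono (hP : IsCondensation P nuDisc) {f g : ℝ → ℝ} (hf : Continuous f)
    (hg : Continuous g) (h : ∀ x ∈ Icc (0 : ℝ) 1, f x ≤ g x) : ∫ x, f x ∂P ≤ ∫ x, g x ∂P := by
  refine integral_mono_ae (hP.integrable hf) (hP.integrable hg) ?_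
  have : ∀ᵐ x ∂P, x ∈ Icc (0 : ℝ) 1 := by rw [ae_iff]; exact hP.compl_Icc
  filter_upwards [this] with x hx using h x hx

lemma integral_eq (hP : IsCondensation P nuDisc) {f : ℝ → ℝ} (hf : Continuous f) :
    ∫ x, f x ∂P = ((∫ x, f (x / 5) ∂P) + (∫ x, f (x / 5 + 4 / 5) ∂P) + ∫ x, f x ∂nuDisc) / 3 := by
  have i1 : Integrable f (P.map S1) :=
    (integrable_map_measure hf.aestronglyMeasurable continuous_S1.aemeasurable).2
      (hP.integrable (hf.comp continuous_S1))
  have i2 : Integrable f (P.map S2) :=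
    (integrable_map_measure hf.aestronglyMeasurable continuous_S2.aemeasurable).2
      (hP.integrable (hf.comp continuous_S2))
  have hc : (1 / 3 : ENNReal) ≠ ⊤ := by simp
  conv_lhs => rw [hP.2]
  rw [integral_add_measure ((i1.smul_measure hc).add_measure (i2.smul_measure hc))
    ((integrable_nuDisc hf).smul_measure hc),
    integral_add_measure (i1.smul_measure hc) (i2.smul_measure hc),
    integral_smul_measure, integral_smul_measure, integral_smul_measure,
    integral_map continuous_S1.aemeasurable hf.aestronglyMeasurable,
    integral_map continuous_S2.aemeasurable hf.aestronglyMeasurable]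
  have e : (1 / 3 : ENNReal).toReal = 1 / 3 := by simp
  simp only [e, S1, S2, smul_eq_mul]
  ring

lemma integral_quadratic (hP : IsCondensation P nuDisc) (u v w : ℝ) :
    ∫ x, (u * x ^ 2 + v * x + w) ∂P = u * (∫ x, x ^ 2 ∂P) + v * (∫ x, x ∂P) + w := by
  have := hP.1
  rw [integral_add (hP.integrable (by fun_prop)) (hP.integrable (by fun_prop)),
    integral_add (hP.integrable (by fun_prop)) (hP.integrable (by fun_prop)),
    integral_const_mul, integral_const_mul]
  simp

lemma integral_sq_sub_eq (hP : IsCondensation P nuDisc) (t : ℝ) :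
    ∫ x, (x - t) ^ 2 ∂P = (∫ x, x ^ 2 ∂P) - 2 * t * (∫ x, x ∂P) + t ^ 2 := by
  have h := hP.integral_quadratic 1 (-2 * t) (t ^ 2)
  rw [show (fun x : ℝ => (x - t) ^ 2) = fun x => 1 * x ^ 2 + -2 * t * x + t ^ 2 by
    funext x; ring, h]
  ring

lemma integral_sq_affine (hP : IsCondensation P nuDisc) (s t : ℝ) :
    ∫ x, (x / 5 + s - t) ^ 2 ∂P =
      (∫ x, x ^ 2 ∂P) / 25 + 2 * (s - t) / 5 * (∫ x, x ∂P) + (s - t) ^ 2 := by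
  have h := hP.integral_quadratic (1 / 25) (2 * (s - t) / 5) ((s - t) ^ 2)
  rw [show (fun x : ℝ => (x / 5 + s - t) ^ 2) =
    fun x => 1 / 25 * x ^ 2 + 2 * (s - t) / 5 * x + (s - t) ^ 2 by funext x; ring, h]
  ring

lemma moments (hP : IsCondensation P nuDisc) :
    ∫ x, x ∂P = 19 / 39 ∧ ∫ x, x ^ 2 ∂P = 19 ^ 2 / 39 ^ 2 + (30232 / 6476925 * 3 - 8 / 1575) * 25 / 2
    := by
  have key : ∀ t : ℝ, (∫ x, x ^ 2 ∂P) - 2 * t * (∫ x, x ∂P) + t ^ 2 =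
      (((∫ x, x ^ 2 ∂P) / 25 + 2 * (0 - t) / 5 * (∫ x, x ∂P) + (0 - t) ^ 2) +
       ((∫ x, x ^ 2 ∂P) / 25 + 2 * (4 / 5 - t) / 5 * (∫ x, x ∂P) + (4 / 5 - t) ^ 2) +
       (8 / 1575 + (7 / 15 - t) ^ 2)) / 3 := by
    intro t
    have h := hP.integral_eq (f := fun x => (x - t) ^ 2) (by fun_prop)
    have h1 := hP.integral_sq_affine 0 t
    simp only [add_zero] at h1
    rw [hP.integral_sq_sub_eq, h1, hP.integral_sq_affine, integral_sq_sub_nuDisc] at h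
    exact h
  have k0 := key 0
  have k1 := key 1
  constructor <;> linarith

lemma integral_S1_sq (hP : IsCondensation P nuDisc) (t : ℝ) :
    ∫ x, (x / 5 - t) ^ 2 ∂P =
      (30232 / 6476925 * 3 - 8 / 1575) / 2 + (t - 19 / 195) ^ 2 := by
  have h := hP.integral_sq_affine 0 t
  simp only [add_zero] at h
  rw [h, hP.moments.1, hP.moments.2]
  ring

lemma integral_S2_sq (hP : IsCondensation P nuDisc) (t : ℝ) :
    ∫ x, (x / 5 + 4 / 5 - t) ^ 2 ∂P =
      (30232 / 6476925 * 3 - 8 / 1575) / 2 + (t - 35 / 39) ^ 2 := by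
  rw [hP.integral_sq_affine, hP.moments.1, hP.moments.2]
  ring

end IsCondensation

/-- The squared distance from `x` to the nearest of the three points `a`, `b`, `c`. -/
noncomputable def minSq (a b c x : ℝ) : ℝ := min (min ((x - a) ^ 2) ((x - b) ^ 2)) ((x - c) ^ 2)

lemma continuous_minSq (a b c : ℝ) : Continuous (minSq a b c) := by unfold minSq; fun_prop

lemma minSq_nonneg (a b c x : ℝ) : 0 ≤ minSq a b c x :=
  le_min (le_min (sq_nonneg _) (sq_nonneg _)) (sq_nonneg _)

lemma sq_sub_le_minSq {a b c x t : ℝ} (ha : 0 ≤ (a - t) * (a + t - 2 * x))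
    (hb : 0 ≤ (b - t) * (b + t - 2 * x)) (hc : 0 ≤ (c - t) * (c + t - 2 * x)) :
    (x - t) ^ 2 ≤ minSq a b c x :=
  le_min (le_min (by linarith) (by linarith)) (by linarith)

lemma minSq_cases (a b c x : ℝ) :
    minSq a b c x = (x - a) ^ 2 ∨ minSq a b c x = (x - b) ^ 2 ∨ minSq a b c x = (x - c) ^ 2 := by
  unfold minSq
  rcases min_choice (min ((x - a) ^ 2) ((x - b) ^ 2)) ((x - c) ^ 2) with h | h <;> rw [h]
  · rcases min_choice ((x - a) ^ 2) ((x - b) ^ 2) with h | h <;> simp [h]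
  · simp

lemma infDist_sq_eq_minSq (a b c x : ℝ) : infDist x {a, b, c} ^ 2 = minSq a b c x := by
  have hne : ({a, b, c} : Set ℝ).Nonempty := ⟨a, by simp⟩
  have hle : ∀ y ∈ ({a, b, c} : Set ℝ), infDist x {a, b, c} ^ 2 ≤ (x - y) ^ 2 := fun y hy => by
    rw [← sq_abs (x - y), ← Real.dist_eq]
    exact pow_le_pow_left₀ infDist_nonneg (infDist_le_dist_of_mem hy) 2
  refine le_antisymm (le_min (le_min (hle a (by simp)) (hle b (by simp))) (hle c (by simp))) ?_
  have hfin : ({a, b, c} : Set ℝ).Finite := by simp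
  obtain ⟨y, hy, e⟩ := hfin.isCompact.exists_infDist_eq_dist hne x
  rw [e, Real.dist_eq, sq_abs]
  rcases hy with rfl | rfl | rfl
  · exact (min_le_left _ _).trans (min_le_left _ _)
  · exact (min_le_left _ _).trans (min_le_right _ _)
  · exact min_le_right _ _

lemma exists_sorted_triple {α : Set ℝ} (hf : α.Finite) (hne : α.Nonempty) (hc : α.ncard ≤ 3) :
    ∃ a b c : ℝ, a ≤ b ∧ b ≤ c ∧ α = {a, b, c} := by
  have h : ∃ a b c : ℝ, α = {a, b, c} := by
    have hpos := (Set.ncard_pos hf).2 hne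
    interval_cases h : α.ncard
    · obtain ⟨a, rfl⟩ := Set.ncard_eq_one.1 h
      exact ⟨a, a, a, by simp⟩
    · obtain ⟨a, b, -, rfl⟩ := Set.ncard_eq_two.1 h
      exact ⟨a, b, b, by simp⟩
    · obtain ⟨a, b, c, -, -, -, rfl⟩ := Set.ncard_eq_three.1 h
      exact ⟨a, b, c, rfl⟩
  obtain ⟨a, b, c, rfl⟩ := h
  rcases le_total a b with h1 | h1 <;> rcases le_total b c with h2 | h2 <;>
    rcases le_total a c with h3 | h3
  · exact ⟨a, b, c, h1, h2, rfl⟩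
  · exact ⟨a, b, c, h1, h2, rfl⟩
  · exact ⟨a, c, b, h3, h2, by ext; simp; tauto⟩
  · exact ⟨c, a, b, h3, h1, by ext; simp; tauto⟩
  · exact ⟨b, a, c, h1, h3, by ext; simp; tauto⟩
  · exact ⟨b, c, a, h2, h3, by ext; simp; tauto⟩
  · exact ⟨c, b, a, h2, h1, by ext; simp; tauto⟩
  · exact ⟨c, b, a, h2, h1, by ext; simp; tauto⟩

/-- Two of three points that are pairwise `1/25`-separated share a nearest point when only `a` and
`b` are close to them. -/
lemma minSq_sum_three_ge {a b c u v w : ℝ} (hu : u + 1 / 25 ≤ v) (hv : v + 1 / 25 ≤ w)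
    (hw : w + 1 / 25 ≤ c) :
    1 / 1250 ≤ minSq a b c u + minSq a b c v + minSq a b c w := by
  have shared : ∀ {x y : ℝ} (s : ℝ), x + 1 / 25 ≤ y → 1 / 1250 ≤ (x - s) ^ 2 + (y - s) ^ 2 := by
    intro x y s h
    nlinarith [sq_nonneg ((x - s) + (y - s))]
  have far : ∀ {x : ℝ}, x + 1 / 25 ≤ c → 1 / 1250 ≤ (x - c) ^ 2 := by
    intro x h
    nlinarith
  have nu := minSq_nonneg a b c u
  have nv := minSq_nonneg a b c v
  have nw := minSq_nonneg a b c w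
  rcases minSq_cases a b c u with e1 | e1 | e1
  · rcases minSq_cases a b c v with e2 | e2 | e2
    · linarith [shared a hu]
    · rcases minSq_cases a b c w with e3 | e3 | e3
      · linarith [shared a (show u + 1 / 25 ≤ w by linarith)]
      · linarith [shared b hv]
      · linarith [far hw]
    · linarith [far (show v + 1 / 25 ≤ c by linarith)]
  · rcases minSq_cases a b c v with e2 | e2 | e2
    · rcases minSq_cases a b c w with e3 | e3 | e3
      · linarith [shared a hv]
      · linarith [shared b (show u + 1 / 25 ≤ w by linarith)]
      · linarith [far hw]
    · linarith [shared b hu]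
    · linarith [far (show v + 1 / 25 ≤ c by linarith)]
  · linarith [far (show u + 1 / 25 ≤ c by linarith)]

namespace IsCondensation

variable {P : Measure ℝ}

lemma integral_minSq_S1_ge (hP : IsCondensation P nuDisc) {a b c : ℝ} (hc : 4 / 5 < c) :
    1 / 7500 ≤ ∫ x, minSq a b c (x / 5) ∂P := by
  have := hP.1
  have hq := continuous_minSq a b c
  have h := hP.integral_eq (f := fun x => minSq a b c (x / 5)) (by fun_prop)
  have hν := two_atoms_le_integral_nuDisc (f := fun x => minSq a b c (x / 5)) (by fun_prop)
    (fun x => minSq_nonneg _ _ _ _)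
  have h0 := minSq_nonneg a b c ((1 / 2) / 5)
  have hm := hP.integral_mono (f := fun _ => (1 / 1250 : ℝ))
    (g := fun x => minSq a b c (x / 5 / 5) + minSq a b c (2 / 5 / 5) +
      minSq a b c ((x / 5 + 4 / 5) / 5)) (by fun_prop) (by fun_prop) (fun x hx =>
        minSq_sum_three_ge (by linarith [hx.2]) (by linarith [hx.1]) (by linarith [hx.2]))
  rw [integral_add (hP.integrable (by fun_prop)) (hP.integrable (by fun_prop)),
    integral_add (hP.integrable (by fun_prop)) (hP.integrable (by fun_prop))] at hm
  simp only [integral_const, probReal_univ, one_smul] at hm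
  have p1 : 0 ≤ ∫ x, minSq a b c (x / 5 / 5) ∂P := integral_nonneg fun x => minSq_nonneg _ _ _ _
  have p2 : 0 ≤ ∫ x, minSq a b c ((x / 5 + 4 / 5) / 5) ∂P :=
    integral_nonneg fun x => minSq_nonneg _ _ _ _
  linarith

lemma integral_minSq_ge_of_mem_Icc (hP : IsCondensation P nuDisc) {a b c : ℝ} (hab : a ≤ b)
    (hbc : b ≤ c) (ha0 : 0 ≤ a) (hc1 : c ≤ 1) :
    30232 / 6476925 ≤ ∫ x, minSq a b c x ∂P ∧
      (∫ x, minSq a b c x ∂P ≤ 30232 / 6476925 → a = 19 / 195 ∧ b = 7 / 15 ∧ c = 35 / 39) := by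
  have hq := continuous_minSq a b c
  have h := hP.integral_eq hq
  have n1 : 0 ≤ ∫ x, minSq a b c (x / 5) ∂P := integral_nonneg fun x => minSq_nonneg _ _ _ _
  have n2 : 0 ≤ ∫ x, minSq a b c (x / 5 + 4 / 5) ∂P :=
    integral_nonneg fun x => minSq_nonneg _ _ _ _
  have n3 : 0 ≤ ∫ x, minSq a b c x ∂nuDisc := integral_nonneg fun x => minSq_nonneg _ _ _ _
  have block1 : ∀ t : ℝ, (∀ x ∈ Icc (0 : ℝ) 1, (x / 5 - t) ^ 2 ≤ minSq a b c (x / 5)) →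
      (30232 / 6476925 * 3 - 8 / 1575) / 2 + (t - 19 / 195) ^ 2 ≤
        ∫ x, minSq a b c (x / 5) ∂P := fun t ht => by
    rw [← hP.integral_S1_sq]
    exact hP.integral_mono (by fun_prop) (by fun_prop) ht
  have block2 : ∀ t : ℝ,
      (∀ x ∈ Icc (0 : ℝ) 1, (x / 5 + 4 / 5 - t) ^ 2 ≤ minSq a b c (x / 5 + 4 / 5)) →
      (30232 / 6476925 * 3 - 8 / 1575) / 2 + (t - 35 / 39) ^ 2 ≤
        ∫ x, minSq a b c (x / 5 + 4 / 5) ∂P := fun t ht => by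
    rw [← hP.integral_S2_sq]
    exact hP.integral_mono (by fun_prop) (by fun_prop) ht
  have block3 : ∀ t : ℝ, (∀ x ∈ Icc (2 / 5 : ℝ) (3 / 5), (x - t) ^ 2 ≤ minSq a b c x) →
      8 / 1575 + (7 / 15 - t) ^ 2 ≤ ∫ x, minSq a b c x ∂nuDisc := fun t ht => by
    rw [← integral_sq_sub_nuDisc]
    exact integral_nuDisc_mono (by fun_prop) hq ht
  have strict : 30232 / 6476925 < ∫ x, minSq a b c x ∂P → 30232 / 6476925 ≤ ∫ x, minSq a b c x ∂P ∧
      (∫ x, minSq a b c x ∂P ≤ 30232 / 6476925 → a = 19 / 195 ∧ b = 7 / 15 ∧ c = 35 / 39) :=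
    fun hlt => ⟨hlt.le, fun hle => absurd hlt (not_lt.2 hle)⟩
  rcases le_or_gt (1 / 5) a with ha | ha
  · apply strict
    have := block1 (1 / 5) fun x hx => by
      obtain ⟨h0, h1⟩ := hx
      exact sq_sub_le_minSq (mul_nonneg (by linarith) (by linarith))
        (mul_nonneg (by linarith) (by linarith))
        (mul_nonneg (by linarith) (by linarith))
    norm_num at this ⊢
    linarith
  rcases le_or_gt c (7 / 10) with hc | hc
  · apply strict
    have := block2 (7 / 10) fun x hx => by
      obtain ⟨h0, h1⟩ := hx
      exact sq_sub_le_minSq (mul_nonneg_of_nonpos_of_nonpos (by linarith) (by linarith))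
        (mul_nonneg_of_nonpos_of_nonpos (by linarith) (by linarith))
        (mul_nonneg_of_nonpos_of_nonpos (by linarith) (by linarith))
    norm_num at this ⊢
    linarith
  rcases le_or_gt c (4 / 5) with hc' | hc'
  · apply strict
    have h2 := block2 (4 / 5) fun x hx => by
      obtain ⟨h0, h1⟩ := hx
      exact sq_sub_le_minSq (mul_nonneg_of_nonpos_of_nonpos (by linarith) (by linarith))
        (mul_nonneg_of_nonpos_of_nonpos (by linarith) (by linarith))
        (mul_nonneg_of_nonpos_of_nonpos (by linarith) (by linarith))
    have h3 := two_atoms_le_integral_nuDisc hq (minSq_nonneg a b c)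
    have h4 : 1 / 10000 ≤ minSq a b c (2 / 5) / 2 + minSq a b c (1 / 2) / 4 := by
      have m1 := minSq_nonneg a b c (2 / 5)
      have m2 := minSq_nonneg a b c (1 / 2)
      rcases minSq_cases a b c (2 / 5) with e1 | e1 | e1
      · nlinarith
      · rcases minSq_cases a b c (1 / 2) with e2 | e2 | e2
        · nlinarith
        · nlinarith [sq_nonneg ((2 / 5 - b) + (1 / 2 - b))]
        · nlinarith
      · nlinarith
    norm_num at h2 ⊢
    linarith
  rcases lt_or_ge (3 / 5) b with hb | hb
  · apply strict
    have := block3 (3 / 5) fun x hx => by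
      obtain ⟨h0, h1⟩ := hx
      exact sq_sub_le_minSq (mul_nonneg_of_nonpos_of_nonpos (by linarith) (by linarith))
        (mul_nonneg (by linarith) (by linarith))
        (mul_nonneg (by linarith) (by linarith))
    norm_num at this ⊢
    linarith
  have h2 := block2 c fun x hx => by
    obtain ⟨h0, h1⟩ := hx
    exact sq_sub_le_minSq (mul_nonneg_of_nonpos_of_nonpos (by linarith) (by linarith))
      (mul_nonneg_of_nonpos_of_nonpos (by linarith) (by linarith))
      (by simp)
  rcases lt_or_ge b (2 / 5) with hb' | hb'
  · apply strict
    have h1 := hP.integral_minSq_S1_ge (a := a) (b := b) hc'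
    have h3 := block3 (2 / 5) fun x hx => by
      obtain ⟨h0, h1⟩ := hx
      exact sq_sub_le_minSq (mul_nonneg_of_nonpos_of_nonpos (by linarith) (by linarith))
        (mul_nonneg_of_nonpos_of_nonpos (by linarith) (by linarith))
        (mul_nonneg (by linarith) (by linarith))
    norm_num at h3 ⊢
    linarith [sq_nonneg (c - 35 / 39)]
  have h1 := block1 a fun x hx => by
    obtain ⟨h0, h1⟩ := hx
    exact sq_sub_le_minSq (by simp)
      (mul_nonneg (by linarith) (by linarith))
      (mul_nonneg (by linarith) (by linarith))
  have h3 := block3 b fun x hx => by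
    obtain ⟨h0, h1⟩ := hx
    exact sq_sub_le_minSq (mul_nonneg_of_nonpos_of_nonpos (by linarith) (by linarith))
      (by simp)
      (mul_nonneg (by linarith) (by linarith))
  have s1 := sq_nonneg (a - 19 / 195)
  have s2 := sq_nonneg (7 / 15 - b)
  have s3 := sq_nonneg (c - 35 / 39)
  refine ⟨by linarith, fun hle => ⟨?_, ?_, ?_⟩⟩
  · exact sub_eq_zero.1 (pow_eq_zero_iff two_ne_zero |>.1 (by linarith))
  · exact (sub_eq_zero.1 (pow_eq_zero_iff two_ne_zero |>.1
      (show (7 / 15 - b) ^ 2 = 0 by linarith))).symm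
  · exact sub_eq_zero.1 (pow_eq_zero_iff two_ne_zero |>.1 (by linarith))

end IsCondensation

/-- The nearest point of `[0, 1]`. -/
noncomputable def clampUnit (y : ℝ) : ℝ := max 0 (min y 1)

lemma clampUnit_mono {x y : ℝ} (h : x ≤ y) : clampUnit x ≤ clampUnit y :=
  max_le_max le_rfl (min_le_min h le_rfl)

lemma eq_of_clampUnit_eq {y t : ℝ} (h : clampUnit y = t) (h0 : 0 < t) (h1 : t < 1) : y = t := by
  unfold clampUnit at h
  grind

lemma sq_sub_clampUnit_le {x y : ℝ} (hx : x ∈ Icc (0 : ℝ) 1) :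
    (x - clampUnit y) ^ 2 ≤ (x - y) ^ 2 := by
  obtain ⟨h0, h1⟩ := hx
  unfold clampUnit
  rcases le_total y 1 with h | h
  · rw [min_eq_left h]
    rcases le_total 0 y with h' | h'
    · rw [max_eq_right h']
    · rw [max_eq_left h']; nlinarith
  · rw [min_eq_right h, max_eq_right zero_le_one]; nlinarith

lemma IsCondensation.integral_minSq_ge {P : Measure ℝ} (hP : IsCondensation P nuDisc) {a b c : ℝ}
    (hab : a ≤ b) (hbc : b ≤ c) :
    30232 / 6476925 ≤ ∫ x, minSq a b c x ∂P ∧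
      (∫ x, minSq a b c x ∂P ≤ 30232 / 6476925 → a = 19 / 195 ∧ b = 7 / 15 ∧ c = 35 / 39) := by
  obtain ⟨h1, h2⟩ := hP.integral_minSq_ge_of_mem_Icc (clampUnit_mono hab) (clampUnit_mono hbc)
    (le_max_left _ _) (max_le zero_le_one (min_le_right _ _))
  have h3 : ∫ x, minSq (clampUnit a) (clampUnit b) (clampUnit c) x ∂P ≤ ∫ x, minSq a b c x ∂P :=
    hP.integral_mono (continuous_minSq _ _ _) (continuous_minSq _ _ _) fun x hx =>
      min_le_min (min_le_min (sq_sub_clampUnit_le hx) (sq_sub_clampUnit_le hx))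
        (sq_sub_clampUnit_le hx)
  refine ⟨h1.trans h3, fun hle => ?_⟩
  obtain ⟨ea, eb, ec⟩ := h2 (h3.trans hle)
  exact ⟨eq_of_clampUnit_eq ea (by norm_num) (by norm_num),
    eq_of_clampUnit_eq eb (by norm_num) (by norm_num),
    eq_of_clampUnit_eq ec (by norm_num) (by norm_num)⟩

lemma IsCondensation.integral_minSq_optimal {P : Measure ℝ} (hP : IsCondensation P nuDisc) :
    ∫ x, minSq (19 / 195) (7 / 15) (35 / 39) x ∂P = 30232 / 6476925 := by
  have hq := continuous_minSq (19 / 195) (7 / 15) (35 / 39)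
  refine le_antisymm ?_ (hP.integral_minSq_ge (by norm_num) (by norm_num)).1
  have h1 := hP.integral_mono (f := fun x => minSq (19 / 195) (7 / 15) (35 / 39) (x / 5))
    (g := fun x => (x / 5 - 19 / 195) ^ 2) (by fun_prop) (by fun_prop)
    fun x _ => (min_le_left _ _).trans (min_le_left _ _)
  have h2 := hP.integral_mono (f := fun x => minSq (19 / 195) (7 / 15) (35 / 39) (x / 5 + 4 / 5))
    (g := fun x => (x / 5 + 4 / 5 - 35 / 39) ^ 2) (by fun_prop) (by fun_prop)
    fun x _ => min_le_right _ _
  have h3 := integral_nuDisc_mono (f := fun x => minSq (19 / 195) (7 / 15) (35 / 39) x)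
    (g := fun x => (x - 7 / 15) ^ 2) (by fun_prop) (by fun_prop)
    fun x _ => (min_le_left _ _).trans (min_le_right _ _)
  rw [hP.integral_S1_sq] at h1
  rw [hP.integral_S2_sq] at h2
  rw [integral_sq_sub_nuDisc] at h3
  rw [hP.integral_eq hq]
  linarith

theorem optimal_three_means_discrete (P : MeasureTheory.Measure ℝ)
    (hP : IsCondensation P nuDisc) :
    (∀ α : Set ℝ, IsOptimalSet P 3 α → α = {19 / 195, 7 / 15, 35 / 39}) ∧
      quantErr P 3 = 30232 / 6476925 := by
  have hd : ∀ a b c : ℝ, distortion P {a, b, c} = ∫ x, minSq a b c x ∂P := fun a b c => by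
    simp only [distortion, infDist_sq_eq_minSq]
  have hV : quantErr P 3 = 30232 / 6476925 := by
    refine IsLeast.csInf_eq ⟨⟨{19 / 195, 7 / 15, 35 / 39}, by simp, ⟨19 / 195, by simp⟩,
      ?_, ?_⟩, ?_⟩
    · grw [Set.ncard_insert_le, Set.ncard_insert_le, Set.ncard_singleton]
    · rw [hd, hP.integral_minSq_optimal]
    · rintro e ⟨α, hf, hne, hc, rfl⟩
      obtain ⟨a, b, c, hab, hbc, rfl⟩ := exists_sorted_triple hf hne hc
      rw [hd]
      exact (hP.integral_minSq_ge hab hbc).1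
  refine ⟨fun α hα => ?_, hV⟩
  obtain ⟨hf, hne, hc, he⟩ := hα
  obtain ⟨a, b, c, hab, hbc, rfl⟩ := exists_sorted_triple hf hne hc
  rw [hd, hV] at he
  obtain ⟨rfl, rfl, rfl⟩ := (hP.integral_minSq_ge hab hbc).2 he.le
  rfl
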